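/- Let d ≥ 3. For every integer n ≥ 0 there is a constant C_n > 0 depending only on d and n such that for every operator P u = Σ_{j,k} a_{jk}(x) D_j D_k u + Σ_k b_k(x) D_k u with smooth coefficients satisfying ‖a_{jk}‖_{0,1,n} < ∞ and ‖b_k‖_{1,0,n} < ∞, and every Schwartz function u: ‖(ad_A^n P) u‖_{L²} ≤ C_n (Σ_{j,k} ‖a_{jk}‖_{0,1,n} + Σ_k ‖b_k‖_{1,0,n}) ‖Δu‖_{L²}. -/

import Mathlib

open MeasureTheory Complex Finset
open scoped ENNReal

noncomputable section

abbrev Euc (d : ℕ) := EuclideanSpace ℝ (Fin d)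

/-- Partial derivative `∂_j` of a complex-valued function on `ℝ^d`. -/
def pd {d : ℕ} (j : Fin d) (u : Euc d → ℂ) : Euc d → ℂ :=
  fun x => fderiv ℝ u x (EuclideanSpace.single j 1)

/-- Iterated partial derivative `∂^α` for a multi-index `α`. -/
def pdAlpha {d : ℕ} (α : Fin d → ℕ) (u : Euc d → ℂ) : Euc d → ℂ :=
  (List.finRange d).foldr (fun j v => (pd j)^[α j] v) u

/-- The Laplacian `Δ = Σ_j ∂_j²`. -/
def lap {d : ℕ} (u : Euc d → ℂ) : Euc d → ℂ :=
  fun x => ∑ j, pd j (pd j u) x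

/-- The operator `x·∇`. -/
def xGrad {d : ℕ} (u : Euc d → ℂ) : Euc d → ℂ :=
  fun x => ∑ j, (x j : ℂ) * pd j u x

/-- Multi-indices `α` on `Fin d` with `|α| ≤ r`. -/
def multiIndices (d r : ℕ) : Finset (Fin d → ℕ) :=
  (Fintype.piFinset fun _ : Fin d => Finset.range (r + 1)).filter
    (fun α => ∑ i, α i ≤ r)

/-- The norm `‖a‖_{o,r,N} = Σ_{n ≤ N, |α| ≤ r} ‖∂^α (x·∇)^n a‖_{L^{d/(o+|α|)}}`,
with the convention `L^{d/0} = L^∞` (in `ℝ≥0∞`, `d/0 = ∞`). -/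
def coefNorm (d o r N : ℕ) (a : Euc d → ℂ) : ℝ≥0∞ :=
  ∑ n ∈ Finset.range (N + 1), ∑ α ∈ multiIndices d r,
    eLpNorm (pdAlpha α ((xGrad (d := d))^[n] a))
      ((d : ℝ≥0∞) / ((o + ∑ i, α i : ℕ) : ℝ≥0∞)) volume

/-- The Sobolev norm `‖v‖_{H^m} = Σ_{|α| ≤ m} ‖∂^α v‖_{L²}`. -/
def sobNorm (d s : ℕ) (u : Euc d → ℂ) : ℝ≥0∞ :=
  ∑ α ∈ multiIndices d s, eLpNorm (pdAlpha α u) 2 volume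

/-- `D_j = -i ∂_j`. -/
def Dop {d : ℕ} (j : Fin d) (u : Euc d → ℂ) : Euc d → ℂ :=
  fun x => -Complex.I * pd j u x

/-- The operator `P u = Σ_{j,k} a_{jk} D_j D_k u + Σ_k b_k D_k u`. -/
def Pop {d : ℕ} (a : Fin d → Fin d → Euc d → ℂ) (b : Fin d → Euc d → ℂ)
    (u : Euc d → ℂ) : Euc d → ℂ :=
  fun x => (∑ j, ∑ k, a j k x * Dop j (Dop k u) x) + ∑ k, b k x * Dop k u x

/-- The generator of dilations `A = (x·∇)/i + d/2`. -/
def Aop {d : ℕ} (u : Euc d → ℂ) : Euc d → ℂ :=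
  fun x => -Complex.I * xGrad u x + ((d : ℂ) / 2) * u x

/-- Iterated commutators `ad_A^0 T = T`, `ad_A^{n+1} T = (ad_A^n T) A - A (ad_A^n T)`. -/
def adA {d : ℕ} : ℕ → ((Euc d → ℂ) → (Euc d → ℂ)) → ((Euc d → ℂ) → (Euc d → ℂ))
  | 0, T => T
  | n + 1, T => fun u x => adA n T (Aop u) x - Aop (adA n T u) x

/-- `P` is symmetric on Schwartz functions. -/
def IsSymmP {d : ℕ} (a : Fin d → Fin d → Euc d → ℂ) (b : Fin d → Euc d → ℂ) : Prop :=
  ∀ u v : SchwartzMap (Euc d) ℂ,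
    ∫ x, Pop a b u x * (starRingEnd ℂ) (v x) = ∫ x, u x * (starRingEnd ℂ) (Pop a b v x)

/-- Smooth with all derivatives bounded. -/
def CinftyBdd {d : ℕ} (f : Euc d → ℂ) : Prop :=
  ContDiff ℝ (⊤ : ℕ∞) f ∧ ∀ n : ℕ, ∃ C : ℝ, ∀ x, ‖iteratedFDeriv ℝ n f x‖ ≤ C

/-- `r̄(d)`: the largest integer strictly smaller than `d/2`. -/
def rbar (d : ℕ) : ℕ := (d - 1) / 2

/-- `‖∇u‖_{L²} = (Σ_j ‖∂_j u‖_{L²}²)^{1/2}`. -/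
def gradNorm {d : ℕ} (u : Euc d → ℂ) : ℝ≥0∞ :=
  (∑ j, eLpNorm (pd j u) 2 volume ^ 2) ^ (1 / 2 : ℝ)

/-- `‖∇u‖_{L²}²` as a real number, for Schwartz `u`. -/
def gradSq {d : ℕ} (u : Euc d → ℂ) : ℝ :=
  ∑ j, ∫ x, ‖pd j u x‖ ^ 2

/-- Japanese bracket `⟨x⟩ = (1+|x|²)^{1/2}`. -/
def jap {d : ℕ} (x : Euc d) : ℝ := Real.sqrt (1 + ‖x‖ ^ 2)

theorem ContDiff.pd {d : ℕ} {f : Euc d → ℂ} (hf : ContDiff ℝ (⊤ : ℕ∞) f) (j : Fin d) :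
    ContDiff ℝ (⊤ : ℕ∞) (pd j f) :=
  (hf.fderiv_right (m := ((⊤ : ℕ∞) : WithTop ℕ∞)) (by simp)).clm_apply contDiff_const

theorem contDiff_coord {d : ℕ} (j : Fin d) :
    ContDiff ℝ (⊤ : ℕ∞) (fun x : Euc d => (x j : ℂ)) :=
  (Complex.ofRealCLM.comp (EuclideanSpace.proj (𝕜 := ℝ) j)).contDiff

theorem ContDiff.xGrad {d : ℕ} {f : Euc d → ℂ} (hf : ContDiff ℝ (⊤ : ℕ∞) f) :
    ContDiff ℝ (⊤ : ℕ∞) (xGrad f) :=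
  ContDiff.sum fun j _ => (contDiff_coord j).mul (hf.pd j)

theorem ContDiff.Dop {d : ℕ} {f : Euc d → ℂ} (hf : ContDiff ℝ (⊤ : ℕ∞) f) (j : Fin d) :
    ContDiff ℝ (⊤ : ℕ∞) (Dop j f) :=
  contDiff_const.mul (hf.pd j)

theorem ContDiff.Aop {d : ℕ} {f : Euc d → ℂ} (hf : ContDiff ℝ (⊤ : ℕ∞) f) :
    ContDiff ℝ (⊤ : ℕ∞) (Aop f) :=
  (contDiff_const.mul hf.xGrad).add (contDiff_const.mul hf)

theorem ContDiff.differentiable_of_top {d : ℕ} {f : Euc d → ℂ}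
    (hf : ContDiff ℝ (⊤ : ℕ∞) f) : Differentiable ℝ f :=
  hf.differentiable (by simp)

theorem pd_add {d : ℕ} {f g : Euc d → ℂ} (hf : Differentiable ℝ f) (hg : Differentiable ℝ g)
    (j : Fin d) (x : Euc d) : pd j (fun y => f y + g y) x = pd j f x + pd j g x := by
  simp only [pd]
  rw [fderiv_fun_add (hf x) (hg x)]
  rfl

theorem pd_mul {d : ℕ} {f g : Euc d → ℂ} (hf : Differentiable ℝ f) (hg : Differentiable ℝ g)
    (j : Fin d) (x : Euc d) :
    pd j (fun y => f y * g y) x = f x * pd j g x + pd j f x * g x := by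
  simp only [pd]
  rw [fderiv_fun_mul (hf x) (hg x)]
  simp [mul_comm]

theorem pd_const_mul {d : ℕ} {f : Euc d → ℂ} (hf : Differentiable ℝ f) (c : ℂ)
    (j : Fin d) (x : Euc d) : pd j (fun y => c * f y) x = c * pd j f x := by
  simp only [pd]
  rw [fderiv_const_mul (hf x)]
  rfl

theorem pd_sum {d : ℕ} {ι : Type*} (s : Finset ι) {f : ι → Euc d → ℂ}
    (hf : ∀ i, Differentiable ℝ (f i)) (j : Fin d) (x : Euc d) :
    pd j (fun y => ∑ i ∈ s, f i y) x = ∑ i ∈ s, pd j (f i) x := by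
  simp only [pd]
  rw [fderiv_fun_sum fun i _ => hf i x]
  simp

theorem pd_coord {d : ℕ} (j k : Fin d) (x : Euc d) :
    pd j (fun y : Euc d => (y k : ℂ)) x = if k = j then 1 else 0 := by
  have h : (fun y : Euc d => (y k : ℂ)) =
    Complex.ofRealCLM.comp (EuclideanSpace.proj (𝕜 := ℝ) k) := rfl
  simp only [pd]
  rw [h, ContinuousLinearMap.fderiv]
  simp [apply_ite]

theorem pd_comm {d : ℕ} {f : Euc d → ℂ} (hf : ContDiff ℝ (⊤ : ℕ∞) f) (j k : Fin d)
    (x : Euc d) : pd j (pd k f) x = pd k (pd j f) x := by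
  have h2 : IsSymmSndFDerivAt ℝ f x :=
    hf.contDiffAt.isSymmSndFDerivAt
      (by simp only [minSmoothness_of_isRCLikeNormedField]; norm_cast)
  have hd : DifferentiableAt ℝ (fderiv ℝ f) x :=
    ((hf.fderiv_right (m := 1) (by norm_cast)).differentiable (by simp)) x
  unfold pd
  rw [fderiv_clm_apply hd (differentiableAt_const _),
    fderiv_clm_apply hd (differentiableAt_const _)]
  simpa using h2 _ _

theorem pd_xGrad {d : ℕ} {f : Euc d → ℂ} (hf : ContDiff ℝ (⊤ : ℕ∞) f) (j : Fin d)
    (x : Euc d) : pd j (xGrad f) x = pd j f x + xGrad (pd j f) x := by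
  unfold xGrad
  rw [pd_sum _ fun k => ((contDiff_coord k).mul (hf.pd k)).differentiable_of_top]
  simp_rw [pd_mul (contDiff_coord _).differentiable_of_top (hf.pd _).differentiable_of_top,
    pd_coord, sum_add_distrib, pd_comm hf j]
  simp [add_comm]

theorem xGrad_add {d : ℕ} {f g : Euc d → ℂ} (hf : Differentiable ℝ f)
    (hg : Differentiable ℝ g) (x : Euc d) :
    xGrad (fun y => f y + g y) x = xGrad f x + xGrad g x := by
  simp [xGrad, pd_add hf hg, mul_add, sum_add_distrib]

theorem xGrad_mul {d : ℕ} {f g : Euc d → ℂ} (hf : Differentiable ℝ f)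
    (hg : Differentiable ℝ g) (x : Euc d) :
    xGrad (fun y => f y * g y) x = f x * xGrad g x + xGrad f x * g x := by
  simp only [xGrad, pd_mul hf hg, mul_add, sum_add_distrib, mul_sum, sum_mul]
  congr 1 <;> exact sum_congr rfl fun _ _ => by ring

theorem xGrad_const_mul {d : ℕ} {f : Euc d → ℂ} (hf : Differentiable ℝ f) (c : ℂ)
    (x : Euc d) : xGrad (fun y => c * f y) x = c * xGrad f x := by
  simp only [xGrad, pd_const_mul hf, mul_sum]
  exact sum_congr rfl fun _ _ => by ring

theorem xGrad_sum {d : ℕ} {ι : Type*} (s : Finset ι) {f : ι → Euc d → ℂ}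
    (hf : ∀ i, Differentiable ℝ (f i)) (x : Euc d) :
    xGrad (fun y => ∑ i ∈ s, f i y) x = ∑ i ∈ s, xGrad (f i) x := by
  simp only [xGrad, pd_sum s hf, mul_sum]
  exact sum_comm

theorem Dop_Aop {d : ℕ} {f : Euc d → ℂ} (hf : ContDiff ℝ (⊤ : ℕ∞) f) (j : Fin d) :
    Dop j (Aop f) = fun x => -I * Dop j f x + Aop (Dop j f) x := by
  funext x
  unfold Aop Dop
  rw [pd_add (contDiff_const.mul hf.xGrad).differentiable_of_top
    (contDiff_const.mul hf).differentiable_of_top,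
    pd_const_mul hf.xGrad.differentiable_of_top, pd_const_mul hf.differentiable_of_top,
    pd_xGrad hf, xGrad_const_mul (hf.pd j).differentiable_of_top]
  ring

theorem Dop_Dop_Aop {d : ℕ} {f : Euc d → ℂ} (hf : ContDiff ℝ (⊤ : ℕ∞) f) (j k : Fin d)
    (x : Euc d) : Dop j (Dop k (Aop f)) x =
      -2 * I * Dop j (Dop k f) x + Aop (Dop j (Dop k f)) x := by
  have hg := hf.Dop k
  have h := congrFun (Dop_Aop hg j) x
  rw [Dop_Aop hf k]
  generalize Dop k f = g at hg h ⊢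
  have hadd : Dop j (fun x => -I * g x + Aop g x) x = -I * Dop j g x + Dop j (Aop g) x := by
    simp only [Dop]
    rw [pd_add (contDiff_const.mul hg).differentiable_of_top hg.Aop.differentiable_of_top,
      pd_const_mul hg.differentiable_of_top]
    ring
  rw [hadd, h]
  ring

theorem Aop_mul {d : ℕ} {f g : Euc d → ℂ} (hf : Differentiable ℝ f)
    (hg : Differentiable ℝ g) (x : Euc d) :
    Aop (fun y => f y * g y) x = f x * Aop g x - I * xGrad f x * g x := by
  simp only [Aop, xGrad_mul hf hg]
  ring

theorem Aop_add {d : ℕ} {f g : Euc d → ℂ} (hf : Differentiable ℝ f)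
    (hg : Differentiable ℝ g) (x : Euc d) :
    Aop (fun y => f y + g y) x = Aop f x + Aop g x := by
  simp only [Aop, xGrad_add hf hg]
  ring

theorem Aop_sum {d : ℕ} {ι : Type*} (s : Finset ι) {f : ι → Euc d → ℂ}
    (hf : ∀ i, Differentiable ℝ (f i)) (x : Euc d) :
    Aop (fun y => ∑ i ∈ s, f i y) x = ∑ i ∈ s, Aop (f i) x := by
  simp only [Aop, xGrad_sum s hf, mul_sum, sum_add_distrib]

/-- The effect of one commutator with `A` on a coefficient of a term of order `c`. -/
def adCoef {d : ℕ} (c : ℂ) (a : Euc d → ℂ) : Euc d → ℂ :=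
  fun x => -I * (c * a x - xGrad a x)

theorem ContDiff.adCoef {d : ℕ} {a : Euc d → ℂ} (ha : ContDiff ℝ (⊤ : ℕ∞) a) (c : ℂ) :
    ContDiff ℝ (⊤ : ℕ∞) (adCoef c a) :=
  contDiff_const.mul ((contDiff_const.mul ha).sub ha.xGrad)

theorem Pop_commutator {d : ℕ} {a : Fin d → Fin d → Euc d → ℂ} {b : Fin d → Euc d → ℂ}
    (ha : ∀ j k, ContDiff ℝ (⊤ : ℕ∞) (a j k)) (hb : ∀ k, ContDiff ℝ (⊤ : ℕ∞) (b k))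
    {u : Euc d → ℂ} (hu : ContDiff ℝ (⊤ : ℕ∞) u) (x : Euc d) :
    Pop a b (Aop u) x - Aop (Pop a b u) x =
      Pop (fun j k => adCoef 2 (a j k)) (fun k => adCoef 1 (b k)) u x := by
  have h2 : ∀ j k, ContDiff ℝ (⊤ : ℕ∞) (fun x => a j k x * Dop j (Dop k u) x) := fun j k =>
    (ha j k).mul ((hu.Dop k).Dop j)
  have h1 : ∀ k, ContDiff ℝ (⊤ : ℕ∞) (fun x => b k x * Dop k u x) := fun k =>
    (hb k).mul (hu.Dop k)
  unfold Pop
  rw [Aop_add (ContDiff.sum fun j _ => ContDiff.sum fun k _ => h2 j k).differentiable_of_top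
    (ContDiff.sum fun k _ => h1 k).differentiable_of_top,
    Aop_sum _ fun j => (ContDiff.sum fun k _ => h2 j k).differentiable_of_top,
    Aop_sum _ fun k => (h1 k).differentiable_of_top]
  simp_rw [Aop_sum _ fun k => (h2 _ k).differentiable_of_top,
    Aop_mul (ha _ _).differentiable_of_top ((hu.Dop _).Dop _).differentiable_of_top,
    Aop_mul (hb _).differentiable_of_top (hu.Dop _).differentiable_of_top, Dop_Dop_Aop hu,
    Dop_Aop hu]
  rw [add_sub_add_comm]
  simp_rw [← sum_sub_distrib, adCoef]
  congr 1
  · exact sum_congr rfl fun _ _ => sum_congr rfl fun _ _ => by ring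
  · exact sum_congr rfl fun _ _ => by ring

theorem ContDiff.adCoef_iterate {d : ℕ} {a : Euc d → ℂ} (ha : ContDiff ℝ (⊤ : ℕ∞) a) (c : ℂ)
    (n : ℕ) : ContDiff ℝ (⊤ : ℕ∞) ((_root_.adCoef c)^[n] a) := by
  induction n with
  | zero => exact ha
  | succ n ih => rw [Function.iterate_succ_apply']; exact ih.adCoef c

/-- The iterated commutator `ad_A^n P` is again a differential operator of the same form. -/
theorem adA_Pop {d : ℕ} {a : Fin d → Fin d → Euc d → ℂ} {b : Fin d → Euc d → ℂ}
    (ha : ∀ j k, ContDiff ℝ (⊤ : ℕ∞) (a j k)) (hb : ∀ k, ContDiff ℝ (⊤ : ℕ∞) (b k)) (n : ℕ)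
    {u : Euc d → ℂ} (hu : ContDiff ℝ (⊤ : ℕ∞) u) :
    adA n (Pop a b) u =
      Pop (fun j k => (adCoef 2)^[n] (a j k)) (fun k => (adCoef 1)^[n] (b k)) u := by
  induction n generalizing u with
  | zero => rfl
  | succ n ih =>
    funext x
    simp only [adA]
    rw [ih hu.Aop, ih hu, Pop_commutator (fun j k => (ha j k).adCoef_iterate 2 n)
      (fun k => (hb k).adCoef_iterate 1 n) hu]
    simp only [Function.iterate_succ_apply']

theorem xGrad_adCoef {d : ℕ} {a : Euc d → ℂ} (ha : ContDiff ℝ (⊤ : ℕ∞) a) (c : ℂ) :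
    xGrad (adCoef c a) = adCoef c (xGrad a) := by
  have h : adCoef c a = fun x => (-I * c) * a x + I * xGrad a x := by
    funext x
    simp only [adCoef]
    ring
  funext x
  rw [h, xGrad_add (contDiff_const.mul ha).differentiable_of_top
    (contDiff_const.mul ha.xGrad).differentiable_of_top,
    xGrad_const_mul ha.differentiable_of_top, xGrad_const_mul ha.xGrad.differentiable_of_top]
  simp only [adCoef]
  ring

theorem ContDiff.xGrad_iterate {d : ℕ} {a : Euc d → ℂ} (ha : ContDiff ℝ (⊤ : ℕ∞) a)
    (n : ℕ) : ContDiff ℝ (⊤ : ℕ∞) ((_root_.xGrad)^[n] a) := by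
  induction n with
  | zero => exact ha
  | succ n ih => rw [Function.iterate_succ_apply']; exact ih.xGrad

theorem xGrad_iterate_adCoef {d : ℕ} {a : Euc d → ℂ} (ha : ContDiff ℝ (⊤ : ℕ∞) a) (c : ℂ)
    (n : ℕ) : xGrad^[n] (adCoef c a) = adCoef c (xGrad^[n] a) := by
  induction n with
  | zero => rfl
  | succ n ih =>
    rw [Function.iterate_succ_apply', ih, xGrad_adCoef (ha.xGrad_iterate n),
      ← Function.iterate_succ_apply' xGrad]

theorem eLpNorm_adCoef_le {d : ℕ} {a : Euc d → ℂ} (ha : ContDiff ℝ (⊤ : ℕ∞) a) (c : ℂ)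
    {p : ℝ≥0∞} (hp : 1 ≤ p) : eLpNorm (adCoef c a) p volume ≤
      ‖c‖ₑ * eLpNorm a p volume + eLpNorm (xGrad a) p volume := by
  have h : adCoef c a = (-I) • (c • a - xGrad a) := rfl
  rw [h, eLpNorm_const_smul]
  calc _ = eLpNorm (c • a - xGrad a) p volume := by simp [enorm_eq_nnnorm]
    _ ≤ eLpNorm (c • a) p volume + eLpNorm (xGrad a) p volume :=
      eLpNorm_sub_le (ha.continuous.aestronglyMeasurable.const_smul c)
        ha.xGrad.continuous.aestronglyMeasurable hp
    _ = _ := by rw [eLpNorm_const_smul]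

theorem eLpNorm_adCoef_iterate_le {d : ℕ} (c : ℂ) {p : ℝ≥0∞} (hp : 1 ≤ p) (n : ℕ)
    {a : Euc d → ℂ} (ha : ContDiff ℝ (⊤ : ℕ∞) a) :
    eLpNorm ((adCoef c)^[n] a) p volume ≤
      (‖c‖ₑ + 1) ^ n * ∑ m ∈ range (n + 1), eLpNorm (xGrad^[m] a) p volume := by
  induction n generalizing a with
  | zero => simp
  | succ n ih =>
    rw [Function.iterate_succ_apply, pow_succ, mul_assoc]
    refine (ih (ha.adCoef c)).trans (mul_le_mul_right ?_ _)
    calc ∑ m ∈ range (n + 1), eLpNorm (xGrad^[m] (adCoef c a)) p volume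
        ≤ ∑ m ∈ range (n + 1), (‖c‖ₑ * eLpNorm (xGrad^[m] a) p volume +
            eLpNorm (xGrad^[m + 1] a) p volume) := by
          refine sum_le_sum fun m _ => ?_
          rw [xGrad_iterate_adCoef ha, Function.iterate_succ_apply']
          exact eLpNorm_adCoef_le (ha.xGrad_iterate m) c hp
      _ ≤ _ := by
          rw [sum_add_distrib, ← mul_sum, add_mul, one_mul]
          refine add_le_add (mul_le_mul_right ?_ _) ?_
          · exact sum_le_sum_of_subset (range_mono (by lia))
          · rw [sum_range_succ' _ (n + 1)]
            exact le_self_add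

theorem sum_eLpNorm_xGrad_iterate_le_coefNorm {d : ℕ} (o r N : ℕ) (a : Euc d → ℂ) :
    ∑ m ∈ range (N + 1), eLpNorm (xGrad^[m] a) ((d : ℝ≥0∞) / (o : ℝ≥0∞)) volume ≤
      coefNorm d o r N a := by
  unfold coefNorm
  refine sum_le_sum fun m _ => ?_
  have h0 : (0 : Fin d → ℕ) ∈ multiIndices d r := by simp [multiIndices]
  have hpd : ∀ v : Euc d → ℂ, pdAlpha 0 v = v := fun v => by
    simp [pdAlpha]
  refine le_trans (le_of_eq ?_) (single_le_sum (fun _ _ => zero_le) h0)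
  simp [hpd]

open SchwartzMap FourierTransform LineDeriv in
theorem SchwartzMap.eLpNorm_two_le_of_norm_fourier_le {d : ℕ} {f g : 𝓢(Euc d, ℂ)}
    (h : ∀ ξ, ‖𝓕 f ξ‖ ≤ ‖𝓕 g ξ‖) : eLpNorm f 2 volume ≤ eLpNorm g 2 volume := by
  rw [← ENNReal.toReal_le_toReal (f.eLpNorm_lt_top 2 volume).ne (g.eLpNorm_lt_top 2 volume).ne,
    ← norm_toLp, ← norm_toLp, ← norm_fourier_toL2_eq f, ← norm_fourier_toL2_eq g, norm_toLp,
    norm_toLp, ENNReal.toReal_le_toReal ((𝓕 f).eLpNorm_lt_top 2 volume).ne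
      ((𝓕 g).eLpNorm_lt_top 2 volume).ne]
  exact eLpNorm_mono h

open SchwartzMap FourierTransform LineDeriv in
theorem fourier_lineDerivOp_single_apply {d : ℕ} (f : 𝓢(Euc d, ℂ)) (j : Fin d) (ξ : Euc d) :
    𝓕 (∂_{EuclideanSpace.single j (1 : ℝ)} f) ξ = (2 * Real.pi * I) * (ξ j * 𝓕 f ξ) := by
  have : (inner ℝ · (EuclideanSpace.single j (1 : ℝ)) : Euc d → ℝ).HasTemperateGrowth :=
    ((innerSL ℝ).flip (EuclideanSpace.single j (1 : ℝ))).hasTemperateGrowth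
  rw [fourier_lineDerivOp_eq, _root_.smul_apply, smulLeftCLM_apply_apply this]
  simp [EuclideanSpace.inner_single_right]

open SchwartzMap FourierTransform LineDeriv in
/-- The Calderón–Zygmund bound `‖∂_j ∂_k u‖ ≤ ‖Δ u‖` in `L²`. -/
theorem eLpNorm_pd_pd_le_lap {d : ℕ} (u : 𝓢(Euc d, ℂ)) (j k : Fin d) :
    eLpNorm (pd j (pd k u)) 2 volume ≤ eLpNorm (lap u) 2 volume := by
  let e : Fin d → Euc d := fun i => EuclideanSpace.single i (1 : ℝ)
  let g : 𝓢(Euc d, ℂ) := ∑ i, ∂_{e i} (∂_{e i} u)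
  have hg : lap u = g := by
    funext x
    simp only [g, _root_.sum_apply]
    rfl
  have hf : pd j (pd k u) = ∂_{e j} (∂_{e k} u) := rfl
  rw [hg, hf]
  refine eLpNorm_two_le_of_norm_fourier_le fun ξ => ?_
  have hF : 𝓕 g = ∑ i, 𝓕 (∂_{e i} (∂_{e i} u)) :=
    map_sum (fourierTransformCLM ℂ) _ _
  rw [hF, _root_.sum_apply]
  simp only [e, fourier_lineDerivOp_single_apply]
  have hs : ∑ i, 2 * (Real.pi : ℂ) * I * (ξ i * (2 * Real.pi * I * (ξ i * 𝓕 u ξ))) =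
      ((∑ i, ξ i ^ 2 : ℝ) : ℂ) * ((2 * Real.pi * I) ^ 2 * 𝓕 u ξ) := by
    push_cast
    rw [sum_mul]
    exact sum_congr rfl fun _ _ => by ring
  have hl : 2 * (Real.pi : ℂ) * I * (ξ j * (2 * Real.pi * I * (ξ k * 𝓕 u ξ))) =
      ((ξ j * ξ k : ℝ) : ℂ) * ((2 * Real.pi * I) ^ 2 * 𝓕 u ξ) := by
    push_cast
    ring
  rw [hs, hl, norm_mul, norm_mul _ (_ * _), Complex.norm_real, Complex.norm_real]
  refine mul_le_mul_of_nonneg_right ?_ (norm_nonneg _)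
  have hle : ∀ i, ξ i ^ 2 ≤ ∑ i, ξ i ^ 2 := fun i =>
    single_le_sum (f := fun i => ξ i ^ 2) (fun _ _ => sq_nonneg _) (mem_univ i)
  rw [Real.norm_eq_abs, Real.norm_eq_abs, abs_of_nonneg ((sq_nonneg _).trans (hle j)),
    abs_le]
  constructor <;> nlinarith [hle j, hle k, sq_nonneg (ξ j + ξ k), sq_nonneg (ξ j - ξ k)]

open SchwartzMap in
theorem eLpNorm_fderiv_le_sum_pd {d : ℕ} (u : 𝓢(Euc d, ℂ)) {p : ℝ≥0∞} (hp : 1 ≤ p) :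
    eLpNorm (fderiv ℝ u) p volume ≤ ∑ j, eLpNorm (pd j u) p volume := by
  have hm : ∀ j, AEStronglyMeasurable (fun x => ‖pd j u x‖) volume := fun j =>
    ((u.smooth ⊤).pd j).continuous.norm.aestronglyMeasurable
  calc eLpNorm (fderiv ℝ u) p volume
      ≤ eLpNorm (∑ j, fun x => ‖pd j u x‖) p volume := by
        refine eLpNorm_mono_real fun x => ?_
        rw [Finset.sum_apply]
        refine ContinuousLinearMap.opNorm_le_bound _ (sum_nonneg fun _ _ => norm_nonneg _)
          fun v => ?_
        have hv : v = ∑ j, v j • EuclideanSpace.single j (1 : ℝ) := by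
          simpa using ((EuclideanSpace.basisFun (Fin d) ℝ).sum_repr v).symm
        conv_lhs => rw [hv]
        rw [map_sum, sum_mul]
        refine (norm_sum_le _ _).trans (sum_le_sum fun j _ => ?_)
        rw [map_smul, norm_smul, mul_comm]
        exact mul_le_mul_of_nonneg_left (PiLp.norm_apply_le v j) (norm_nonneg _)
    _ ≤ ∑ j, eLpNorm (fun x => ‖pd j u x‖) p volume := eLpNorm_sum_le (fun j _ => hm j) hp
    _ = _ := sum_congr rfl fun j _ => eLpNorm_norm _

open Filter Topology in
/-- The Gagliardo–Nirenberg–Sobolev inequality, for functions in `L^p` which need not have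
compact support. -/
theorem eLpNorm_le_eLpNorm_fderiv_of_eLpNorm_ne_top {E F : Type*} [NormedAddCommGroup E]
    [InnerProductSpace ℝ E] [FiniteDimensional ℝ E] [MeasurableSpace E] [BorelSpace E]
    [NormedAddCommGroup F] [NormedSpace ℝ F] [FiniteDimensional ℝ F]
    (μ : Measure E) [μ.IsAddHaarMeasure] {u : E → F} (hu : ContDiff ℝ 1 u) {p p' : NNReal}
    (hp : 1 ≤ p) (hn : 0 < Module.finrank ℝ E)
    (hp' : (p' : ℝ)⁻¹ = (p : ℝ)⁻¹ - (Module.finrank ℝ E : ℝ)⁻¹) (hup : eLpNorm u p μ ≠ ⊤) :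
    eLpNorm u p' μ ≤ SNormLESNormFDerivOfEqConst F μ p * eLpNorm (fderiv ℝ u) p μ := by
  have hp1 : (1 : ℝ≥0∞) ≤ p := by exact_mod_cast hp
  let χ : ContDiffBump (0 : E) := ⟨1, 2, one_pos, one_lt_two⟩
  have hχ : ContDiff ℝ 1 χ := χ.contDiff
  obtain ⟨M, hM⟩ := (χ.hasCompactSupport.fderiv (𝕜 := ℝ)).exists_bound_of_continuous
    (hχ.continuous_fderiv one_ne_zero)
  have hM0 : 0 ≤ M := (norm_nonneg _).trans (hM 0)
  let c : ℕ → ℝ := fun n => ((n : ℝ) + 1)⁻¹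
  have hc : ∀ n, 0 < c n := fun n => by positivity
  have hc0 : Tendsto c atTop (𝓝 0) := by
    simpa [c, one_div] using tendsto_one_div_add_atTop_nhds_zero_nat (𝕜 := ℝ)
  let f : ℕ → E → F := fun n x => χ (c n • x) • u x
  have hχn : ∀ n, ContDiff ℝ 1 fun x => χ (c n • x) := fun n =>
    hχ.comp (contDiff_const_smul _)
  have hf : ∀ n, ContDiff ℝ 1 (f n) := fun n => (hχn n).smul hu
  have hfs : ∀ n, HasCompactSupport (f n) := fun n =>
    (χ.hasCompactSupport.comp_smul (hc n).ne').smul_right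
  have hd : ∀ n x, ‖fderiv ℝ (f n) x‖ ≤ ‖‖fderiv ℝ u x‖ + (c n * M) • ‖u x‖‖ := fun n x => by
    have h1 : HasFDerivAt (fun y => χ (c n • y)) (c n • fderiv ℝ χ (c n • x)) x := by
      have := ((hχ.differentiable one_ne_zero) (c n • x)).hasFDerivAt.comp x
        ((hasFDerivAt_id x).const_smul (c n))
      exact this.congr_fderiv (by ext v; simp)
    have h2 := h1.smul ((hu.differentiable one_ne_zero) x).hasFDerivAt
    have h3 : fderiv ℝ (f n) x = _ := h2.fderiv
    rw [h3, Real.norm_of_nonneg (by have := hc n; positivity)]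
    refine (norm_add_le _ _).trans (add_le_add ?_ ?_)
    · rw [norm_smul, Real.norm_of_nonneg χ.nonneg]
      exact mul_le_of_le_one_left (norm_nonneg _) χ.le_one
    · rw [ContinuousLinearMap.norm_smulRight_apply, norm_smul, Real.norm_of_nonneg (hc n).le]
      exact mul_le_mul_of_nonneg_right (mul_le_mul_of_nonneg_left (hM _) (hc n).le)
        (norm_nonneg _)
  have hm1 : AEStronglyMeasurable (fun x => ‖fderiv ℝ u x‖) μ :=
    (hu.continuous_fderiv one_ne_zero).norm.aestronglyMeasurable
  have hm2 : AEStronglyMeasurable (fun x => ‖u x‖) μ :=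
    hu.continuous.norm.aestronglyMeasurable
  have hbound : ∀ n, eLpNorm (f n) p' μ ≤ SNormLESNormFDerivOfEqConst F μ p *
      (eLpNorm (fderiv ℝ u) p μ + ENNReal.ofReal (c n * M) * eLpNorm u p μ) := fun n => by
    refine (eLpNorm_le_eLpNorm_fderiv_of_eq μ (hf n) (hfs n) hp hn hp').trans
      (mul_le_mul_right ?_ _)
    calc eLpNorm (fderiv ℝ (f n)) p μ
        ≤ eLpNorm ((fun x => ‖fderiv ℝ u x‖) + (c n * M) • fun x => ‖u x‖) p μ :=
          eLpNorm_mono (hd n)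
      _ ≤ _ := eLpNorm_add_le hm1 (hm2.const_smul _) hp1
      _ = _ := by
        rw [eLpNorm_const_smul, eLpNorm_norm, eLpNorm_norm,
          Real.enorm_of_nonneg (mul_nonneg (hc n).le hM0)]
  have hlim : ∀ x, Tendsto (fun n => f n x) atTop (𝓝 (u x)) := fun x => by
    have h0 : Tendsto (fun n => c n • x) atTop (𝓝 0) := by
      simpa using hc0.smul_const x
    have h1 := (hχ.continuous.tendsto 0).comp h0
    rw [χ.one_of_mem_closedBall (by simp [χ.rIn_pos.le])] at h1
    simpa using h1.smul_const (u x)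
  refine (Lp.eLpNorm_lim_le_liminf_eLpNorm (fun n => (hf n).continuous.aestronglyMeasurable)
    u (ae_of_all _ hlim)).trans ((liminf_le_liminf (Eventually.of_forall hbound)).trans_eq ?_)
  refine Tendsto.liminf_eq ?_
  have ht : Tendsto (fun n => ENNReal.ofReal (c n * M) * eLpNorm u p μ) atTop (𝓝 0) := by
    have := ENNReal.Tendsto.mul_const (b := eLpNorm u p μ)
      (ENNReal.tendsto_ofReal (hc0.mul_const M)) (Or.inr hup)
    simpa using this
  simpa using ENNReal.Tendsto.const_mul (tendsto_const_nhds.add ht) (Or.inr ENNReal.coe_ne_top)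

open SchwartzMap in
theorem exists_eLpNorm_mul_Dop_le {d : ℕ} (hd : 3 ≤ d) :
    ∃ K : NNReal, ∀ (b : Euc d → ℂ), Continuous b → ∀ (k : Fin d) (u : 𝓢(Euc d, ℂ)),
      eLpNorm (fun x => b x * Dop k u x) 2 volume ≤
        K * eLpNorm b d volume * eLpNorm (lap u) 2 volume := by
  have hd0 : (0 : NNReal) < d := by exact_mod_cast (by lia : 0 < d)
  have hlt : (d : NNReal)⁻¹ < 2⁻¹ :=
    inv_strictAnti₀ two_pos (by exact_mod_cast (by lia : 2 < d))
  let q : NNReal := (2⁻¹ - (d : NNReal)⁻¹)⁻¹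
  have hqr : (q : ℝ)⁻¹ = ((2 : NNReal) : ℝ)⁻¹ - (Module.finrank ℝ (Euc d) : ℝ)⁻¹ := by
    simp [q, NNReal.coe_sub hlt.le]
  have hq0 : q ≠ 0 := inv_ne_zero (tsub_pos_of_lt hlt).ne'
  have hH : ENNReal.HolderTriple (d : ℝ≥0∞) q 2 := by
    refine ⟨?_⟩
    rw [show (d : ℝ≥0∞) = ((d : NNReal) : ℝ≥0∞) by simp, ← ENNReal.coe_inv hd0.ne',
      ← ENNReal.coe_inv hq0, show (2 : ℝ≥0∞) = ((2 : NNReal) : ℝ≥0∞) by simp,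
      ← ENNReal.coe_inv two_ne_zero, ← ENNReal.coe_add, inv_inv, add_tsub_cancel_of_le hlt.le]
  let S : NNReal := SNormLESNormFDerivOfEqConst ℂ (volume : Measure (Euc d)) ((2 : NNReal) : ℝ)
  refine ⟨S * d, fun b hb k u => ?_⟩
  let v : 𝓢(Euc d, ℂ) := LineDeriv.lineDerivOp (EuclideanSpace.single k (1 : ℝ)) u
  have hv : (v : Euc d → ℂ) = pd k u := rfl
  have hsob : eLpNorm v q volume ≤ S * (d * eLpNorm (lap u) 2 volume) := by
    refine (eLpNorm_le_eLpNorm_fderiv_of_eLpNorm_ne_top volume (v.smooth 1) one_le_two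
      (by simp; lia) hqr (v.eLpNorm_lt_top _ volume).ne).trans (mul_le_mul_right ?_ _)
    refine (eLpNorm_fderiv_le_sum_pd v (by simp)).trans ?_
    refine (sum_le_card_nsmul _ _ (eLpNorm (lap u) 2 volume) fun j _ => ?_).trans_eq (by simp)
    rw [hv]
    exact eLpNorm_pd_pd_le_lap u j k
  calc eLpNorm (fun x => b x * Dop k u x) 2 volume
      = eLpNorm (b • ⇑v) 2 volume := by
        refine eLpNorm_congr_norm_ae (ae_of_all _ fun x => ?_)
        simp [Dop, hv]
    _ ≤ eLpNorm b d volume * eLpNorm v q volume :=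
        eLpNorm_smul_le_mul_eLpNorm v.continuous.aestronglyMeasurable hb.aestronglyMeasurable
    _ ≤ eLpNorm b d volume * (S * (d * eLpNorm (lap u) 2 volume)) := mul_le_mul_right hsob _
    _ = _ := by push_cast; ring

open SchwartzMap in
theorem eLpNorm_mul_Dop_Dop_le {d : ℕ} {a : Euc d → ℂ} (ha : Continuous a) (j k : Fin d)
    (u : 𝓢(Euc d, ℂ)) : eLpNorm (fun x => a x * Dop j (Dop k u) x) 2 volume ≤
      eLpNorm a ⊤ volume * eLpNorm (lap u) 2 volume := by
  have hu : ContDiff ℝ (⊤ : ℕ∞) u := u.smooth ⊤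
  calc eLpNorm (fun x => a x * Dop j (Dop k u) x) 2 volume
      = eLpNorm (a • pd j (pd k u)) 2 volume := by
        refine eLpNorm_congr_norm_ae (ae_of_all _ fun x => ?_)
        unfold Dop
        rw [pd_const_mul (hu.pd k).differentiable_of_top]
        simp
    _ ≤ eLpNorm a ⊤ volume * eLpNorm (pd j (pd k u)) 2 volume :=
        eLpNorm_smul_le_mul_eLpNorm ((hu.pd k).pd j).continuous.aestronglyMeasurable
          ha.aestronglyMeasurable
    _ ≤ _ := mul_le_mul_right (eLpNorm_pd_pd_le_lap u j k) _

/-- For every `n` there is `C_n > 0` (depending only on `d` and `n`) such that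
`‖(ad_A^n P) u‖_{L²} ≤ C_n (Σ_{j,k} ‖a_{jk}‖_{0,1,n} + Σ_k ‖b_k‖_{1,0,n}) ‖Δu‖_{L²}`
for all Schwartz `u` and all `P` with smooth coefficients of finite norms. -/
theorem statement5 (d : ℕ) (hd : 3 ≤ d) (n : ℕ) :
    ∃ C : ℝ, 0 < C ∧
      ∀ (a : Fin d → Fin d → Euc d → ℂ) (b : Fin d → Euc d → ℂ),
        (∀ j k, ContDiff ℝ (⊤ : ℕ∞) (a j k)) → (∀ k, ContDiff ℝ (⊤ : ℕ∞) (b k)) →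
        (∀ j k, coefNorm d 0 1 n (a j k) ≠ ⊤) →
        (∀ k, coefNorm d 1 0 n (b k) ≠ ⊤) →
        ∀ u : SchwartzMap (Euc d) ℂ,
          eLpNorm (adA n (Pop a b) ⇑u) 2 volume ≤
            ENNReal.ofReal C *
              ((∑ j : Fin d, ∑ k : Fin d, coefNorm d 0 1 n (a j k)) +
                ∑ k : Fin d, coefNorm d 1 0 n (b k)) *
              eLpNorm (lap ⇑u) 2 volume := by
  obtain ⟨K, hK⟩ := exists_eLpNorm_mul_Dop_le hd
  refine ⟨3 ^ n * (1 + K), by positivity, fun a b ha hb _ _ u => ?_⟩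
  have hu : ContDiff ℝ (⊤ : ℕ∞) u := u.smooth ⊤
  set L := eLpNorm (lap u) 2 volume
  have hd0 : (d : ℝ≥0∞) ≠ 0 := by exact_mod_cast (by lia : d ≠ 0)
  have hC : ENNReal.ofReal (3 ^ n * (1 + K)) = 3 ^ n * (1 + K) := by
    rw [ENNReal.ofReal_mul (by positivity), ENNReal.ofReal_pow (by norm_num),
      ENNReal.ofReal_add zero_le_one K.coe_nonneg]
    simp
  have ha' := fun j k => (ha j k).adCoef_iterate 2 n
  have hb' := fun k => (hb k).adCoef_iterate 1 n
  have ha2 : ∀ j k, eLpNorm (fun x => (adCoef 2)^[n] (a j k) x * Dop j (Dop k u) x) 2 volume ≤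
      3 ^ n * (1 + K) * coefNorm d 0 1 n (a j k) * L := fun j k => by
    refine (eLpNorm_mul_Dop_Dop_le (ha' j k).continuous j k u).trans (mul_le_mul_left ?_ _)
    refine (eLpNorm_adCoef_iterate_le 2 le_top n (ha j k)).trans (mul_le_mul' ?_ ?_)
    · have h3 : ‖(2 : ℂ)‖ₑ + 1 = 3 := by
        rw [← ofReal_norm]
        norm_num
      rw [h3]
      exact le_mul_of_one_le_right' le_self_add
    · simpa [ENNReal.div_zero hd0] using sum_eLpNorm_xGrad_iterate_le_coefNorm 0 1 n (a j k)
  have hb2 : ∀ k, eLpNorm (fun x => (adCoef 1)^[n] (b k) x * Dop k u x) 2 volume ≤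
      3 ^ n * (1 + K) * coefNorm d 1 0 n (b k) * L := fun k => by
    refine (hK _ (hb' k).continuous k u).trans (mul_le_mul_left ?_ _)
    rw [mul_comm (3 ^ n : ℝ≥0∞), mul_assoc]
    refine mul_le_mul' le_add_self ?_
    refine (eLpNorm_adCoef_iterate_le 1 (by exact_mod_cast (by lia : 1 ≤ d)) n (hb k)).trans
      (mul_le_mul' ?_ ?_)
    · refine pow_le_pow_left' ?_ n
      rw [← ofReal_norm]
      norm_num
    · simpa using sum_eLpNorm_xGrad_iterate_le_coefNorm 1 0 n (b k)
  have hma : ∀ j k, AEStronglyMeasurable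
      (fun x => (adCoef 2)^[n] (a j k) x * Dop j (Dop k u) x) volume := fun j k =>
    ((ha' j k).mul ((hu.Dop k).Dop j)).continuous.aestronglyMeasurable
  have hmb : ∀ k, AEStronglyMeasurable
      (fun x => (adCoef 1)^[n] (b k) x * Dop k u x) volume := fun k =>
    ((hb' k).mul (hu.Dop k)).continuous.aestronglyMeasurable
  have hP : adA n (Pop a b) u =
      (∑ j, ∑ k, fun x => (adCoef 2)^[n] (a j k) x * Dop j (Dop k u) x) +
        ∑ k, fun x => (adCoef 1)^[n] (b k) x * Dop k u x := by
    rw [adA_Pop ha hb n hu]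
    funext x
    simp [Pop, Finset.sum_apply]
  rw [hC, hP]
  calc _ ≤ (∑ j, ∑ k, 3 ^ n * (1 + K) * coefNorm d 0 1 n (a j k) * L) +
        ∑ k, 3 ^ n * (1 + K) * coefNorm d 1 0 n (b k) * L := by
        refine (eLpNorm_add_le (Finset.aestronglyMeasurable_sum _ fun j _ =>
          Finset.aestronglyMeasurable_sum _ fun k _ => hma j k)
          (Finset.aestronglyMeasurable_sum _ fun k _ => hmb k) one_le_two).trans
          (add_le_add ?_ ?_)
        · refine (eLpNorm_sum_le (fun j _ => Finset.aestronglyMeasurable_sum _ fun k _ => hma j k)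
            one_le_two).trans (sum_le_sum fun j _ => ?_)
          exact (eLpNorm_sum_le (fun k _ => hma j k) one_le_two).trans
            (sum_le_sum fun k _ => ha2 j k)
        · exact (eLpNorm_sum_le (fun k _ => hmb k) one_le_two).trans
            (sum_le_sum fun k _ => hb2 k)
    _ = _ := by simp only [mul_add (_ * _), add_mul _ _ L, mul_sum, sum_mul]
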